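/- (Theorem 3) Let M be a Moore machine with initial state q0, let A ⊆ Q be its set of absorbing states, let α : P → P be a symbol renaming, and let x be a string over P. Suppose that (i) δt*(q0, x) ∈ A, (ii) δt*(q0, x ∘ α) ∈ A, and (iii) α works for x, i.e. δo**(q0, x) = δo**(q0, x ∘ α). Then α works for every string having x as a prefix: δo**(q0, x + y) = δo**(q0, (x + y) ∘ α) for all strings y over P. -/

import Mathlib

/-- A Moore machine over input alphabet `P`, state set `Q`, and output alphabet `O`,
with initial state `q0`, transition function `δt` and output function `δo`. -/
structure MooreMachine (P Q O : Type*) where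
  q0 : Q
  δt : Q → P → Q
  δo : Q → O

namespace MooreMachine

variable {P Q O : Type*}

/-- The transition function over strings: `δt*(q, ε) = q`,
`δt*(q, p + x) = δt*(δt(q, p), x)`. -/
def deltaTStar (M : MooreMachine P Q O) : Q → List P → Q
  | q, [] => q
  | q, p :: x => M.deltaTStar (M.δt q p) x

/-- The output function over strings: `δo*(q, x) = δo(δt*(q, x))`. -/
def deltaOStar (M : MooreMachine P Q O) (q : Q) (x : List P) : O :=
  M.δo (M.deltaTStar q x)

/-- The string of outputs `δo**(q, x) = [δo*(q, x|1), ..., δo*(q, x|T)]`,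
where `x|i` is the prefix of `x` of length `i`. -/
def deltaOStarStar (M : MooreMachine P Q O) (q : Q) (x : List P) : List O :=
  (List.range x.length).map (fun i => M.deltaOStar q (x.take (i + 1)))

/-- A state is absorbing if every transition from it loops back to it. -/
def Absorbing (M : MooreMachine P Q O) (q : Q) : Prop :=
  ∀ p : P, M.δt q p = q

end MooreMachine

namespace MooreMachine

theorem deltaTStar_append {P Q O : Type*} (M : MooreMachine P Q O) (q : Q) (x y : List P) :
    M.deltaTStar q (x ++ y) = M.deltaTStar (M.deltaTStar q x) y := by
  induction x generalizing q with
  | nil => rfl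
  | cons p x ih => exact ih (M.δt q p)

theorem Absorbing.deltaTStar_eq {P Q O : Type*} {M : MooreMachine P Q O} {q : Q}
    (h : M.Absorbing q) (y : List P) : M.deltaTStar q y = q := by
  induction y with
  | nil => rfl
  | cons p y ih => rw [deltaTStar, h p, ih]

theorem Absorbing.deltaOStar_append {P Q O : Type*} {M : MooreMachine P Q O} {q : Q} {x : List P}
    (h : M.Absorbing (M.deltaTStar q x)) (y : List P) :
    M.deltaOStar q (x ++ y) = M.deltaOStar q x := by
  rw [deltaOStar, deltaTStar_append, h.deltaTStar_eq, deltaOStar]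

/-- A renaming works for `x` exactly when it preserves the output on every nonempty prefix. -/
theorem deltaOStarStar_eq_map_iff {P Q O : Type*} (M : MooreMachine P Q O) (q : Q) (α : P → P)
    (x : List P) :
    M.deltaOStarStar q x = M.deltaOStarStar q (x.map α) ↔
      ∀ i < x.length,
        M.deltaOStar q (x.take (i + 1)) = M.deltaOStar q ((x.take (i + 1)).map α) := by
  simp only [deltaOStarStar, List.length_map, List.map_inj_left, List.mem_range, List.map_take]

/-- If a renaming works for `x`, the outputs after all of `x` agree, also when `x` is empty. -/
theorem deltaOStar_eq_of_deltaOStarStar_eq {P Q O : Type*} {M : MooreMachine P Q O} {q : Q}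
    {α : P → P} {x : List P} (h : M.deltaOStarStar q x = M.deltaOStarStar q (x.map α)) :
    M.deltaOStar q x = M.deltaOStar q (x.map α) := by
  rcases Nat.eq_zero_or_pos x.length with hx | hx
  · rw [List.length_eq_zero_iff.mp hx, List.map_nil]
  · have hlast := (M.deltaOStarStar_eq_map_iff q α x).mp h (x.length - 1) (by omega)
    rwa [Nat.sub_add_cancel hx, List.take_length] at hlast

end MooreMachine

/-- (Theorem 3) Let `A` be the set of absorbing states. If `x` and `x ∘ α` both reach
states in `A` from the initial state and `α` works for `x`, then `α` works for every
string having `x` as a prefix. -/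
theorem works_extension_of_absorbing {P Q O : Type*} [Fintype P] [Fintype Q] [Fintype O]
    (M : MooreMachine P Q O) (A : Set Q) (hA : A = {q : Q | M.Absorbing q})
    (α : P → P) (x : List P)
    (h1 : M.deltaTStar M.q0 x ∈ A)
    (h2 : M.deltaTStar M.q0 (x.map α) ∈ A)
    (h3 : M.deltaOStarStar M.q0 x = M.deltaOStarStar M.q0 (x.map α)) :
    ∀ y : List P,
      M.deltaOStarStar M.q0 (x ++ y) = M.deltaOStarStar M.q0 ((x ++ y).map α) := by
  subst hA
  intro y
  rw [MooreMachine.deltaOStarStar_eq_map_iff]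
  intro i _
  rcases lt_or_ge i x.length with hi | hi
  · rw [List.take_append_of_le_length hi]
    exact (M.deltaOStarStar_eq_map_iff M.q0 α x).mp h3 i hi
  · rw [List.take_append, List.take_of_length_le (by omega), List.map_append,
      MooreMachine.Absorbing.deltaOStar_append h1, MooreMachine.Absorbing.deltaOStar_append h2]
    exact MooreMachine.deltaOStar_eq_of_deltaOStarStar_eq h3
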